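/- arXiv:1410.3173 — 2 statements merged into one kernel-verified Lean document; each statement's English description precedes it below -/
import Mathlib

section
/- (Nash–Williams) Let G be a finite simple graph and k ≥ 1 an integer. The edge set of G can be partitioned into k forests if and only if for every subset S of vertices with |S| ≥ 2, the number of edges of G with both endpoints in S is at most k(|S| − 1). Consequently the arboricity of G, the minimal number of forests needed to cover all edges, equals the maximum over subgraphs H with at least 2 vertices of ⌈m_H/(n_H − 1)⌉, where n_H and m_H are the numbers of vertices and edges of H. -/
open Finset

namespace NashWilliams

open SimpleGraph

variable {V ι : Type*}

/-- Reachability in `G` implies reachability in `H` as soon as this holds for adjacent vertices. -/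
lemma reachable_of_forall_adj {G H : SimpleGraph V} (h : ∀ u v, G.Adj u v → H.Reachable u v)
    {u v : V} (huv : G.Reachable u v) : H.Reachable u v := by
  obtain ⟨p⟩ := huv
  induction p with
  | nil => rfl
  | cons hadj _ ih => exact (h _ _ hadj).trans ih

/-- The edges of `G` inside `S` are counted by the induced subgraph. -/
lemma ncard_edgeSet_induce (G : SimpleGraph V) (S : Set V) :
    (G.induce S).edgeSet.ncard = {a ∈ G.edgeSet | ∀ v ∈ a, v ∈ S}.ncard := by
  rw [← Set.ncard_image_of_injective _ (Sym2.map.injective (Subtype.val_injective (p := (· ∈ S))))]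
  congr 1
  ext a
  induction a with | _ u v
  constructor
  · rintro ⟨b, hb, hab⟩
    induction b with | _ x y
    simp only [mem_edgeSet, comap_adj, Function.Embedding.subtype_apply] at hb
    rw [← hab]
    simp [hb]
  · rintro ⟨huv, hS⟩
    exact ⟨s(⟨u, hS u (by simp)⟩, ⟨v, hS v (by simp)⟩), by simpa using huv, by simp⟩

/-- A forest has at most `|S| - 1` edges inside a nonempty vertex set `S`. -/
lemma ncard_edges_le_of_isAcyclic [Finite V] {F : SimpleGraph V} (hF : F.IsAcyclic)
    (S : Finset V) (hS : S.Nonempty) :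
    {a ∈ F.edgeSet | ∀ v ∈ a, v ∈ S}.ncard ≤ S.card - 1 := by
  have : Nonempty (S : Set V) := hS.to_subtype
  obtain ⟨T, hFT, -, hT⟩ := (connected_top (V := (S : Set V))).exists_isTree_le_of_le_of_isAcyclic
    le_top (hF.induce S)
  have h₁ := (isTree_iff_connected_and_card.mp hT).2
  have h₂ := Set.ncard_le_ncard (edgeSet_subset_edgeSet.mpr hFT) (Set.toFinite _)
  have h₃ := ncard_edgeSet_induce F S
  simp only [Finset.mem_coe] at h₃
  rw [Nat.card_coe_set_eq, Nat.card_coe_set_eq, Set.ncard_coe_finset] at h₁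
  omega

/-- A graph that is connected on `S` has at least `|S| - 1` edges inside `S`. -/
lemma le_ncard_edges_of_connected_induce [Finite V] {H : SimpleGraph V} {S : Finset V}
    (hH : (H.induce (S : Set V)).Connected) :
    S.card - 1 ≤ {a ∈ H.edgeSet | ∀ v ∈ a, v ∈ S}.ncard := by
  have h₁ := hH.card_vert_le_card_edgeSet_add_one
  have h₃ := ncard_edgeSet_induce H S
  simp only [Finset.mem_coe] at h₃
  rw [Nat.card_coe_set_eq, Nat.card_coe_set_eq, Set.ncard_coe_finset] at h₁
  omega

/-- In a forest, exchanging an edge of a path for an edge joining its ends gives a forest. -/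
lemma isAcyclic_exchange {F : SimpleGraph V} (hF : F.IsAcyclic) {x y : V} {p : F.Walk x y}
    (hp : p.IsPath) {e : Sym2 V} (he : e ∈ p.edges) :
    (F.deleteEdges {e} ⊔ edge x y).IsAcyclic := by
  refine IsAcyclic.sup_edge_of_not_reachable (fun h => ?_) (hF.anti (deleteEdges_le _))
  obtain ⟨q, hq⟩ := h.exists_isPath
  have hpq : p = q.mapLe (deleteEdges_le _) := congrArg Subtype.val <|
    (hF.subsingleton_path x y).elim ⟨p, hp⟩ ⟨_, hq.mapLe (deleteEdges_le _)⟩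
  have hq' : e ∈ q.edges := by simpa [hpq] using he
  simpa using q.edges_subset_edgeSet hq'

/-- The graph formed by the members of `E` that `c` colors with `i`. -/
def colorGraph (E : Set (Sym2 V)) (c : Sym2 V → ι) (i : ι) : SimpleGraph V :=
  fromEdgeSet {a | a ∈ E ∧ c a = i}

lemma colorGraph_adj {E : Set (Sym2 V)} {c : Sym2 V → ι} {i : ι} {u v : V} :
    (colorGraph E c i).Adj u v ↔ (s(u, v) ∈ E ∧ c s(u, v) = i) ∧ u ≠ v := by
  simp [colorGraph]

lemma mem_of_mem_edgeSet_colorGraph {E : Set (Sym2 V)} {c : Sym2 V → ι} {i : ι} {a : Sym2 V}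
    (ha : a ∈ (colorGraph E c i).edgeSet) : a ∈ E ∧ c a = i := by
  simp only [colorGraph, edgeSet_fromEdgeSet] at ha
  exact ha.1

/-- Every color class of `c` on `E` is a forest. -/
def IsForestColoring (E : Set (Sym2 V)) (c : Sym2 V → ι) : Prop :=
  ∀ i, (colorGraph E c i).IsAcyclic

section Exchange

variable [DecidableEq V] {E : Set (Sym2 V)}

/-- If no forest coloring of `E` exists, then the ends of the only uncolored edge are joined in
every color. -/
lemma reachable_of_not_isForestColoring
    (hE : ∀ c : Sym2 V → ι, ¬ IsForestColoring E c) {c : Sym2 V → ι} {x y : V}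
    (hc : IsForestColoring (E \ {s(x, y)}) c) (i : ι) :
    (colorGraph (E \ {s(x, y)}) c i).Reachable x y := by
  by_contra h
  refine hE (Function.update c s(x, y) i) fun j => ?_
  by_cases hij : j = i
  · subst hij
    refine (IsAcyclic.sup_edge_of_not_reachable h (hc j)).anti fun u v huv => ?_
    rw [sup_adj, colorGraph_adj, edge_adj]
    rw [colorGraph_adj] at huv
    by_cases he : s(u, v) = s(x, y)
    · right
      simpa [huv.2] using he
    · left
      simpa [he, Function.update_apply] using huv
  · refine (hc j).anti fun u v huv => ?_
    rw [colorGraph_adj] at huv ⊢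
    by_cases he : s(u, v) = s(x, y)
    · simp only [he, Function.update_self] at huv
      exact absurd huv.1.2.symm hij
    · simpa [he, Function.update_apply] using huv

/-- Coloring `s(x, y)` with `i` and uncoloring an edge of the path from `x` to `y` in color `i`
preserves being a forest coloring. -/
lemma IsForestColoring.exchange {c : Sym2 V → ι} {x y : V}
    (hc : IsForestColoring (E \ {s(x, y)}) c) {i : ι}
    {p : (colorGraph (E \ {s(x, y)}) c i).Walk x y} (hp : p.IsPath) {e : Sym2 V}
    (he : e ∈ p.edges) : IsForestColoring (E \ {e}) (Function.update c s(x, y) i) := by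
  intro j
  by_cases hij : j = i
  · subst hij
    refine (isAcyclic_exchange (hc j) hp he).anti fun u v huv => ?_
    rw [sup_adj, deleteEdges_adj, colorGraph_adj, edge_adj]
    rw [colorGraph_adj] at huv
    by_cases he : s(u, v) = s(x, y)
    · right
      simpa [huv.2] using he
    · left
      simp only [Function.update_apply, he, if_false] at huv
      exact ⟨⟨⟨⟨huv.1.1.1, he⟩, huv.1.2⟩, huv.2⟩, huv.1.1.2⟩
  · refine (hc j).anti fun u v huv => ?_
    rw [colorGraph_adj] at huv ⊢
    by_cases he : s(u, v) = s(x, y)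
    · simp only [he, Function.update_self] at huv
      exact absurd huv.1.2.symm hij
    · simp only [Function.update_apply, he, if_false] at huv
      exact ⟨⟨⟨huv.1.1.1, he⟩, huv.1.2⟩, huv.2⟩

/-- `Exchangeable E c₀ e₀ c e` means that the coloring `c` of `E \ {e}` arises from the coloring
`c₀` of `E \ {e₀}` by repeatedly coloring the uncolored edge and uncoloring another edge of the
same color, staying among forest colorings. -/
inductive Exchangeable (E : Set (Sym2 V)) (c₀ : Sym2 V → ι) (e₀ : Sym2 V) :
    (Sym2 V → ι) → Sym2 V → Prop
  | refl : Exchangeable E c₀ e₀ c₀ e₀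
  | step {c : Sym2 V → ι} {e e' : Sym2 V} : Exchangeable E c₀ e₀ c e → e' ∈ E → e' ≠ e →
      IsForestColoring (E \ {e'}) (Function.update c e (c e')) →
      Exchangeable E c₀ e₀ (Function.update c e (c e')) e'

/-- The edges that can be made the uncolored one. -/
def releasable (E : Set (Sym2 V)) (c₀ : Sym2 V → ι) (e₀ : Sym2 V) : Set (Sym2 V) :=
  {e | ∃ c, Exchangeable E c₀ e₀ c e}

variable {c₀ : Sym2 V → ι} {e₀ : Sym2 V}

lemma Exchangeable.isForestColoring (h₀ : IsForestColoring (E \ {e₀}) c₀) {c : Sym2 V → ι}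
    {e : Sym2 V} (h : Exchangeable E c₀ e₀ c e) : IsForestColoring (E \ {e}) c := by
  cases h with
  | refl => exact h₀
  | step _ _ _ h => exact h

/-- The ends of the uncolored edge are joined by releasable edges in every color. -/
lemma Exchangeable.reachable (hE : ∀ c : Sym2 V → ι, ¬ IsForestColoring E c)
    (h₀ : IsForestColoring (E \ {e₀}) c₀) {c : Sym2 V → ι} {x y : V}
    (h : Exchangeable E c₀ e₀ c s(x, y)) (i : ι) :
    (colorGraph ((E \ {s(x, y)}) ∩ releasable E c₀ e₀) c i).Reachable x y := by
  have hc := h.isForestColoring h₀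
  obtain ⟨p, hp⟩ := (reachable_of_not_isForestColoring hE hc i).exists_isPath
  refine ⟨p.transfer _ fun a ha => ?_⟩
  have ha' := p.edges_subset_edgeSet ha
  obtain ⟨⟨haE, hne⟩, hca⟩ := mem_of_mem_edgeSet_colorGraph ha'
  have hX : a ∈ releasable E c₀ e₀ :=
    ⟨_, h.step haE hne (by rw [hca]; exact hc.exchange hp ha)⟩
  simp only [colorGraph, edgeSet_fromEdgeSet]
  exact ⟨⟨⟨⟨haE, hne⟩, hX⟩, hca⟩, not_isDiag_of_mem_edgeSet _ ha'⟩

/-- Exchanges do not change the components spanned by releasable edges in a given color. -/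
lemma Exchangeable.reachable_iff (hE : ∀ c : Sym2 V → ι, ¬ IsForestColoring E c)
    (h₀ : IsForestColoring (E \ {e₀}) c₀) {c : Sym2 V → ι} {e : Sym2 V}
    (h : Exchangeable E c₀ e₀ c e) (i : ι) (u v : V) :
    (colorGraph ((E \ {e}) ∩ releasable E c₀ e₀) c i).Reachable u v ↔
      (colorGraph ((E \ {e₀}) ∩ releasable E c₀ e₀) c₀ i).Reachable u v := by
  induction h with
  | refl => rfl
  | @step c e e' hce he'E hne hc' ih =>
    rw [← ih]
    have hce' := hce.step he'E hne hc'
    constructor <;> refine reachable_of_forall_adj fun a b hab => ?_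
    · by_cases he : s(a, b) = e
      · subst he
        exact hce.reachable hE h₀ i
      · refine Adj.reachable ?_
        rw [colorGraph_adj] at hab ⊢
        simp only [Function.update_apply, he, if_false] at hab
        exact ⟨⟨⟨⟨hab.1.1.1.1, he⟩, hab.1.1.2⟩, hab.1.2⟩, hab.2⟩
    · by_cases he : s(a, b) = e'
      · subst he
        exact hce'.reachable hE h₀ i
      · refine Adj.reachable ?_
        rw [colorGraph_adj] at hab ⊢
        rw [Function.update_of_ne hab.1.1.1.2]
        exact ⟨⟨⟨⟨hab.1.1.1.1, he⟩, hab.1.1.2⟩, hab.1.2⟩, hab.2⟩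

/-- If a forest coloring of `E \ {s(x, y)}` exists but none of `E`, then some vertex set containing
`x` and `y` is connected in every color. -/
lemma exists_connected_induce {x y : V} (hE : ∀ c : Sym2 V → ι, ¬ IsForestColoring E c)
    (h₀ : IsForestColoring (E \ {s(x, y)}) c₀) :
    ∃ S : Set V, x ∈ S ∧ y ∈ S ∧
      ∀ i, ((colorGraph (E \ {s(x, y)}) c₀ i).induce S).Connected := by
  set X := releasable E c₀ s(x, y)
  have hX (i : ι) (u v : V) : (fromEdgeSet X).Reachable u v ↔
      (colorGraph ((E \ {s(x, y)}) ∩ X) c₀ i).Reachable u v := by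
    constructor <;> refine reachable_of_forall_adj fun a b hab => ?_
    · obtain ⟨c, hc⟩ := ((fromEdgeSet_adj _).mp hab).1
      exact (hc.reachable_iff hE h₀ i a b).mp (hc.reachable hE h₀ i)
    · rw [colorGraph_adj] at hab
      exact Adj.reachable ((fromEdgeSet_adj _).mpr ⟨hab.1.1.2, hab.2⟩)
  refine ⟨{v | (fromEdgeSet X).Reachable v x}, Reachable.rfl, ?_, fun i => ?_⟩
  · by_cases hxy : x = y
    · subst hxy
      exact Reachable.rfl
    · have hmem : s(x, y) ∈ X := ⟨c₀, .refl⟩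
      exact (Adj.reachable ((fromEdgeSet_adj X).mpr ⟨hmem, hxy⟩)).symm
  · have hS : {v | (fromEdgeSet X).Reachable v x} =
        ((colorGraph ((E \ {s(x, y)}) ∩ X) c₀ i).connectedComponentMk x).supp := by
      ext v
      simp [hX i]
    rw [hS]
    refine (ConnectedComponent.connected_toSimpleGraph _).mono fun u v huv => ?_
    have huv' : (colorGraph ((E \ {s(x, y)}) ∩ X) c₀ i).Adj u v := huv
    rw [colorGraph_adj] at huv'
    exact colorGraph_adj.mpr ⟨⟨huv'.1.1.1, huv'.1.2⟩, huv'.2⟩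

end Exchange

/-- Every vertex set `S` with at least two elements spans at most `k (|S| - 1)` members of `E`. -/
def IsSparse (E : Set (Sym2 V)) (k : ℕ) : Prop :=
  ∀ S : Finset V, 2 ≤ S.card → {a ∈ E | ∀ v ∈ a, v ∈ S}.ncard ≤ k * (S.card - 1)

/-- A forest coloring of a sparse set with one edge removed yields one of the whole set. -/
lemma exists_isForestColoring_of_sdiff_singleton [Finite V] [Fintype ι] {E : Set (Sym2 V)} {x y : V}
    (hxy : x ≠ y) (hmem : s(x, y) ∈ E) (hE : IsSparse E (Fintype.card ι))
    {c₀ : Sym2 V → ι} (h₀ : IsForestColoring (E \ {s(x, y)}) c₀) :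
    ∃ c : Sym2 V → ι, IsForestColoring E c := by
  classical
  by_contra! hno
  obtain ⟨S, hx, hy, hS⟩ := exists_connected_induce hno h₀
  lift S to Finset V using S.toFinite
  have hcard : 2 ≤ S.card := Finset.one_lt_card.mpr ⟨x, hx, y, hy, hxy⟩
  set B := {a ∈ E | ∀ v ∈ a, v ∈ S}
  have hB : B.ncard ≤ _ := hE S hcard
  have heB : s(x, y) ∈ B := ⟨hmem, by simpa using ⟨hx, hy⟩⟩
  have hsum : (B \ {s(x, y)}).ncard =
      ∑ i, {a ∈ B \ {s(x, y)} | c₀ a = i}.ncard := by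
    have hfin : (B \ {s(x, y)}).Finite := Set.toFinite _
    rw [Set.ncard_eq_toFinset_card _ hfin, Finset.card_eq_sum_card_fiberwise
      (f := c₀) (t := Finset.univ) fun _ _ => Finset.mem_coe.mpr (Finset.mem_univ _)]
    refine Finset.sum_congr rfl fun i _ => ?_
    rw [← Set.ncard_coe_finset]
    congr 1
    ext a
    simp
  have hle (i : ι) : S.card - 1 ≤ {a ∈ B \ {s(x, y)} | c₀ a = i}.ncard := by
    refine (le_ncard_edges_of_connected_induce (hS i)).trans
      (Set.ncard_le_ncard (fun a ha => ?_) (Set.toFinite _))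
    obtain ⟨⟨haE, hne⟩, hca⟩ := mem_of_mem_edgeSet_colorGraph ha.1
    exact ⟨⟨⟨haE, ha.2⟩, hne⟩, hca⟩
  have hlower : Fintype.card ι * (S.card - 1) ≤ (B \ {s(x, y)}).ncard := by
    rw [hsum, ← smul_eq_mul]
    exact Finset.card_nsmul_le_sum _ _ _ fun i _ => hle i
  have := Set.ncard_sdiff_singleton_add_one heB (Set.toFinite _)
  omega

/-- A sparse set of edges has a forest coloring. -/
lemma IsSparse.exists_isForestColoring [Finite V] [Fintype ι] [Nonempty ι] {E : Set (Sym2 V)}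
    (hdiag : ∀ a ∈ E, ¬ a.IsDiag) (hE : IsSparse E (Fintype.card ι)) :
    ∃ c : Sym2 V → ι, IsForestColoring E c := by
  induction E, E.toFinite using Set.Finite.induction_on with
  | empty =>
    refine ⟨fun _ => Classical.arbitrary ι, fun i => ?_⟩
    simp [colorGraph]
  | @insert e E he _ ih =>
    have hE' : IsSparse E (Fintype.card ι) := fun S hS =>
      (Set.ncard_le_ncard (t := {a ∈ insert e E | ∀ v ∈ a, v ∈ S})
        (fun a ha => ⟨Set.mem_insert_of_mem _ ha.1, ha.2⟩) (Set.toFinite _)).trans (hE S hS)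
    obtain ⟨c₀, h₀⟩ := ih (fun a ha => hdiag a (Set.mem_insert_of_mem _ ha)) hE'
    induction e with | _ x y
    refine exists_isForestColoring_of_sdiff_singleton (c₀ := c₀)
      (by simpa using hdiag _ (Set.mem_insert _ _)) (Set.mem_insert _ _) hE ?_
    rwa [Set.insert_sdiff_self_of_notMem he]

/-- A graph covered by `k` forests is sparse. -/
lemma isSparse_of_cover [Finite V] {G : SimpleGraph V} {k : ℕ} {F : Fin k → SimpleGraph V}
    (hF : ∀ i, (F i).IsAcyclic) (hcover : ∀ e ∈ G.edgeSet, ∃ i, e ∈ (F i).edgeSet) :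
    IsSparse G.edgeSet k := by
  intro S hS
  have hsub : {a ∈ G.edgeSet | ∀ v ∈ a, v ∈ S} ⊆
      ⋃ i, {a ∈ (F i).edgeSet | ∀ v ∈ a, v ∈ S} := fun a ha => by
    obtain ⟨i, hi⟩ := hcover a ha.1
    exact Set.mem_iUnion.mpr ⟨i, hi, ha.2⟩
  calc _ ≤ (⋃ i, {a ∈ (F i).edgeSet | ∀ v ∈ a, v ∈ S}).ncard :=
        Set.ncard_le_ncard hsub (Set.toFinite _)
    _ ≤ ∑ i, {a ∈ (F i).edgeSet | ∀ v ∈ a, v ∈ S}.ncard := Set.ncard_iUnion_le_of_fintype _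
    _ ≤ ∑ _i : Fin k, (S.card - 1) := Finset.sum_le_sum fun i _ =>
        ncard_edges_le_of_isAcyclic (hF i) S (Finset.card_pos.mp (by omega))
    _ = k * (S.card - 1) := by simp

/-- The edges of a sparse graph can be partitioned into forests. -/
lemma IsSparse.exists_partition [Finite V] {G : SimpleGraph V} {k : ℕ}
    (hG : IsSparse G.edgeSet k) :
    ∃ F : Fin k → SimpleGraph V, (∀ i, F i ≤ G ∧ (F i).IsAcyclic) ∧
      ∀ e ∈ G.edgeSet, ∃! i, e ∈ (F i).edgeSet := by
  classical
  obtain rfl | hk := Nat.eq_zero_or_pos k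
  · refine ⟨fun _ => ⊥, fun i => i.elim0, fun e he => ?_⟩
    induction e with | _ u v
    have hG' := hG {u, v} (Finset.card_pair (G.ne_of_adj he)).ge
    rw [zero_mul, Nat.le_zero, Set.ncard_eq_zero (Set.toFinite _)] at hG'
    exact (Set.eq_empty_iff_forall_notMem.mp hG' s(u, v) ⟨he, by simp⟩).elim
  · have : Nonempty (Fin k) := ⟨⟨0, hk⟩⟩
    obtain ⟨c, hc⟩ := IsSparse.exists_isForestColoring (ι := Fin k)
      (fun a => G.not_isDiag_of_mem_edgeSet) (by simpa using hG)
    have hmem (e : Sym2 V) (he : e ∈ G.edgeSet) (i : Fin k) :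
        e ∈ (colorGraph G.edgeSet c i).edgeSet ↔ c e = i := by
      simp [colorGraph, edgeSet_fromEdgeSet, he, G.not_isDiag_of_mem_edgeSet he]
    refine ⟨colorGraph G.edgeSet c, fun i => ⟨fun u v huv => (colorGraph_adj.mp huv).1.1, hc i⟩,
      fun e he => ⟨c e, (hmem e he _).mpr rfl, fun i hi => ((hmem e he i).mp hi).symm⟩⟩

lemma exists_cover_iff_isSparse [Finite V] {G : SimpleGraph V} {k : ℕ} :
    (∃ F : Fin k → SimpleGraph V, (∀ i, F i ≤ G ∧ (F i).IsAcyclic) ∧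
      ∀ e ∈ G.edgeSet, ∃ i, e ∈ (F i).edgeSet) ↔ IsSparse G.edgeSet k := by
  refine ⟨fun ⟨F, hF, hcover⟩ => isSparse_of_cover (fun i => (hF i).2) hcover, fun h => ?_⟩
  obtain ⟨F, hF, hpart⟩ := h.exists_partition
  exact ⟨F, hF, fun e he => (hpart e he).exists⟩

lemma ceil_density_le_iff {m n j : ℕ} (hn : 2 ≤ n) :
    ⌈(m : ℚ) / ((n : ℚ) - 1)⌉₊ ≤ j ↔ m ≤ j * (n - 1) := by
  have hn' : (n : ℚ) - 1 = ((n - 1 : ℕ) : ℚ) := by push_cast [show 1 ≤ n by omega]; rfl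
  rw [Nat.ceil_le, hn', div_le_iff₀ (by exact_mod_cast (by omega : 0 < n - 1))]
  exact_mod_cast Iff.rfl

/-- Sparsity means that `k` bounds the rounded densities of all subgraphs. -/
lemma isSparse_iff_mem_upperBounds [Finite V] {G : SimpleGraph V} {k : ℕ} :
    IsSparse G.edgeSet k ↔ k ∈ upperBounds {j : ℕ | ∃ H : G.Subgraph, 2 ≤ H.verts.ncard ∧
      j = ⌈(H.edgeSet.ncard : ℚ) / ((H.verts.ncard : ℚ) - 1)⌉₊} := by
  constructor
  · rintro hG _ ⟨H, hH, rfl⟩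
    rw [ceil_density_le_iff hH]
    have hfin : H.verts.Finite := Set.toFinite _
    rw [Set.ncard_eq_toFinset_card _ hfin] at hH ⊢
    refine (Set.ncard_le_ncard (fun a ha => ?_) (Set.toFinite _)).trans (hG _ hH)
    exact ⟨H.edgeSet_subset ha, fun v hv => by simpa using H.mem_verts_of_mem_edge ha hv⟩
  · intro hk S hS
    have hverts : ((⊤ : G.Subgraph).induce S).verts.ncard = S.card := by simp
    have h := hk ⟨(⊤ : G.Subgraph).induce S, by rwa [hverts], rfl⟩
    rw [ceil_density_le_iff (by rwa [hverts]), hverts] at h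
    refine (Set.ncard_le_ncard (fun a ha => ?_) (Set.toFinite _)).trans h
    obtain ⟨ha, haS⟩ := ha
    induction a with | _ u v
    simp only [Subgraph.mem_edgeSet, Subgraph.induce_adj, Subgraph.top_adj]
    exact ⟨haS u (by simp), haS v (by simp), ha⟩

end NashWilliams

/-- **Nash–Williams.** For a finite simple graph `G` and an integer `k ≥ 1`, the edge set of
`G` can be partitioned into `k` forests if and only if for every subset `S` of vertices with
`|S| ≥ 2`, the number of edges of `G` with both endpoints in `S` is at most `k(|S| - 1)`.
Consequently the arboricity of `G` — the minimal number of forests needed to cover all edges —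
equals the maximum over subgraphs `H` of `G` with at least `2` vertices of
`⌈m_H / (n_H - 1)⌉`, where `n_H` and `m_H` are the numbers of vertices and edges of `H`. -/
theorem nashWilliams_arboricity {V : Type*} [Fintype V] [DecidableEq V]
    (G : SimpleGraph V) [DecidableRel G.Adj] (k : ℕ) (hk : 1 ≤ k) :
    ((∃ F : Fin k → SimpleGraph V,
        (∀ i, F i ≤ G ∧ (F i).IsAcyclic) ∧
        ∀ e ∈ G.edgeSet, ∃! i, e ∈ (F i).edgeSet) ↔
      (∀ S : Finset V, 2 ≤ S.card →
        (G.edgeFinset.filter (fun e => ∀ v ∈ e, v ∈ S)).card ≤ k * (S.card - 1))) ∧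
    sInf {j : ℕ | ∃ F : Fin j → SimpleGraph V,
        (∀ i, F i ≤ G ∧ (F i).IsAcyclic) ∧
        ∀ e ∈ G.edgeSet, ∃ i, e ∈ (F i).edgeSet} =
      sSup {j : ℕ | ∃ H : G.Subgraph, 2 ≤ H.verts.ncard ∧
        j = ⌈(H.edgeSet.ncard : ℚ) / ((H.verts.ncard : ℚ) - 1)⌉₊} := by
  classical
  have hsparse : (∀ S : Finset V, 2 ≤ S.card →
      (G.edgeFinset.filter (fun e => ∀ v ∈ e, v ∈ S)).card ≤ k * (S.card - 1)) ↔
      NashWilliams.IsSparse G.edgeSet k := by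
    refine forall₂_congr fun S _ => ?_
    rw [← Set.ncard_coe_finset]
    simp
  refine ⟨?_, ?_⟩
  · rw [hsparse]
    exact ⟨fun ⟨F, hF, hpart⟩ => NashWilliams.isSparse_of_cover (fun i => (hF i).2)
      fun e he => (hpart e he).exists, fun h => h.exists_partition⟩
  · simp_rw [NashWilliams.exists_cover_iff_isSparse, NashWilliams.isSparse_iff_mem_upperBounds]
    have hfin : {j : ℕ | ∃ H : G.Subgraph, 2 ≤ H.verts.ncard ∧
        j = ⌈(H.edgeSet.ncard : ℚ) / ((H.verts.ncard : ℚ) - 1)⌉₊}.Finite :=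
      (Set.finite_range fun H : G.Subgraph =>
        ⌈(H.edgeSet.ncard : ℚ) / ((H.verts.ncard : ℚ) - 1)⌉₊).subset
          fun _ ⟨H, _, hj⟩ => ⟨H, hj.symm⟩
    exact IsLeast.csInf_eq (isLUB_csSup' hfin.bddAbove)
end

section
/- The characteristic length of the flat torus R²/Z² equals (√2 + arcsinh(1))/6; that is, ∫₀¹ ∫₀¹ √(m(x)² + m(y)²) dx dy = (√2 + arcsinh(1))/6, where m(t) = min(t, 1−t). Equivalently, 4 ∫₀^{1/2} ∫₀^{1/2} √(x² + y²) dx dy = (√2 + arcsinh(1))/6. -/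
open Real

open intervalIntegral in
/-- A function of the distance to the nearest integer integrates over the unit interval to twice
its integral over the first half. -/
lemma integral_comp_min_one_sub {f : ℝ → ℝ} (hf : Continuous f) :
    ∫ t in (0 : ℝ)..1, f (min t (1 - t)) = 2 * ∫ t in (0 : ℝ)..(1 / 2), f t := by
  have hc : Continuous fun t : ℝ => f (min t (1 - t)) := by fun_prop
  rw [← integral_add_adjacent_intervals (hc.intervalIntegrable 0 (1 / 2))
    (hc.intervalIntegrable (1 / 2) 1)]
  have left_half : ∫ t in (0 : ℝ)..(1 / 2), f (min t (1 - t)) = ∫ t in (0 : ℝ)..(1 / 2), f t := by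
    refine integral_congr fun t ht => ?_
    rw [Set.uIcc_of_le (by norm_num)] at ht
    simp only [min_eq_left (show t ≤ 1 - t by linarith [ht.2])]
  have right_half : ∫ t in (1 / 2 : ℝ)..1, f (min t (1 - t)) = ∫ t in (0 : ℝ)..(1 / 2), f t := by
    have reflect : ∫ t in (1 / 2 : ℝ)..1, f (min t (1 - t)) = ∫ t in (1 / 2 : ℝ)..1, f (1 - t) := by
      refine integral_congr fun t ht => ?_
      rw [Set.uIcc_of_le (by norm_num)] at ht
      simp only [min_eq_right (show 1 - t ≤ t by linarith [ht.1])]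
    rw [reflect, integral_comp_sub_left f 1]
    norm_num
  rw [left_half, right_half, two_mul]

lemma hasDerivAt_sqrt_sq_add_sq {x : ℝ} (hx : 0 < x) (y : ℝ) :
    HasDerivAt (fun t => √(x ^ 2 + t ^ 2)) (y / √(x ^ 2 + y ^ 2)) y := by
  have hpos : 0 < x ^ 2 + y ^ 2 := by positivity
  refine HasDerivAt.congr_deriv ((((hasDerivAt_id y).pow 2).const_add (x ^ 2)).sqrt hpos.ne') ?_
  have hs : 0 < √(x ^ 2 + y ^ 2) := sqrt_pos.2 hpos
  simp only [id, Pi.pow_apply]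
  field_simp
  simp

lemma sqrt_one_add_div_sq {x : ℝ} (hx : 0 < x) (y : ℝ) :
    √(1 + (y / x) ^ 2) = √(x ^ 2 + y ^ 2) / x := by
  rw [show 1 + (y / x) ^ 2 = (x ^ 2 + y ^ 2) / x ^ 2 by field_simp,
    sqrt_div (by positivity), sqrt_sq hx.le]

lemma hasDerivAt_arsinh_div_const {x : ℝ} (hx : 0 < x) (y : ℝ) :
    HasDerivAt (fun t => arsinh (t / x)) (1 / √(x ^ 2 + y ^ 2)) y := by
  refine HasDerivAt.congr_deriv (((hasDerivAt_id y).div_const x).arsinh) ?_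
  have hpos : 0 < √(x ^ 2 + y ^ 2) := by positivity
  simp only [id, sqrt_one_add_div_sq hx, smul_eq_mul]
  field_simp

lemma hasDerivAt_arsinh_const_div (a : ℝ) {x : ℝ} (hx : 0 < x) :
    HasDerivAt (fun t => arsinh (a / t)) (-a / (x * √(x ^ 2 + a ^ 2))) x := by
  refine HasDerivAt.congr_deriv (((hasDerivAt_const x a).div (hasDerivAt_id x) hx.ne').arsinh) ?_
  have hpos : 0 < √(x ^ 2 + a ^ 2) := by positivity
  simp only [Pi.div_apply, id, sqrt_one_add_div_sq hx, smul_eq_mul]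
  field_simp
  ring

lemma integral_sqrt_sq_add_sq {x : ℝ} (hx : 0 < x) (a : ℝ) :
    ∫ y in (0 : ℝ)..a, √(x ^ 2 + y ^ 2) =
      (a * √(x ^ 2 + a ^ 2) + x ^ 2 * arsinh (a / x)) / 2 := by
  have hderiv (y : ℝ) : HasDerivAt
      (fun t => (t * √(x ^ 2 + t ^ 2) + x ^ 2 * arsinh (t / x)) / 2) (√(x ^ 2 + y ^ 2)) y := by
    refine HasDerivAt.congr_deriv ((((hasDerivAt_id y).mul (hasDerivAt_sqrt_sq_add_sq hx y)).add
      ((hasDerivAt_arsinh_div_const hx y).const_mul (x ^ 2))).div_const 2) ?_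
    have hpos : 0 < √(x ^ 2 + y ^ 2) := by positivity
    have hsq : √(x ^ 2 + y ^ 2) ^ 2 = x ^ 2 + y ^ 2 := sq_sqrt (by positivity)
    simp only [id]
    field_simp
    linear_combination -hsq
  rw [intervalIntegral.integral_eq_sub_of_hasDerivAt (fun y _ => hderiv y)
    ((by fun_prop : Continuous fun y : ℝ => √(x ^ 2 + y ^ 2)).intervalIntegrable _ _)]
  simp

lemma abs_arsinh_le (x : ℝ) : |arsinh x| ≤ |x| := by
  have h (y : ℝ) (hy : 0 ≤ y) : |arsinh y| ≤ |y| := by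
    rw [abs_of_nonneg (arsinh_nonneg_iff.2 hy), abs_of_nonneg hy]
    simpa using self_le_sinh_iff.2 (arsinh_nonneg_iff.2 hy)
  rcases le_total 0 x with hx | hx
  · exact h x hx
  · simpa using h (-x) (neg_nonneg.2 hx)

lemma continuous_pow_three_mul_arsinh_const_div (a : ℝ) :
    Continuous fun x : ℝ => x ^ 3 * arsinh (a / x) := by
  refine continuous_iff_continuousAt.2 fun x => ?_
  rcases eq_or_ne x 0 with rfl | hx
  · have hbound (t : ℝ) : ‖t ^ 3 * arsinh (a / t)‖ ≤ |a| * t ^ 2 := by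
      rcases eq_or_ne t 0 with rfl | ht
      · simp
      · calc ‖t ^ 3 * arsinh (a / t)‖ ≤ |t| ^ 3 * |a / t| := by
              rw [norm_eq_abs, abs_mul, abs_pow]
              exact mul_le_mul_of_nonneg_left (abs_arsinh_le _) (by positivity)
          _ = |a| * t ^ 2 := by
              rw [abs_div, ← sq_abs t]
              have := abs_pos.2 ht
              field_simp
    have hlim : Filter.Tendsto (fun t : ℝ => |a| * t ^ 2) (nhds 0) (nhds 0) := by
      simpa using (by fun_prop : Continuous fun t : ℝ => |a| * t ^ 2).tendsto 0
    simpa [ContinuousAt] using squeeze_zero_norm hbound hlim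
  · exact (continuousAt_id.pow 3).mul (continuousAt_const.div continuousAt_id hx).arsinh

/-- The integral of the distance to a corner over a square of side `a`. -/
lemma integral_integral_sqrt_sq_add_sq {a : ℝ} (ha : 0 < a) :
    ∫ x in (0 : ℝ)..a, ∫ y in (0 : ℝ)..a, √(x ^ 2 + y ^ 2) =
      a ^ 3 * (√2 + arsinh 1) / 3 := by
  have hderiv (x : ℝ) (hx : x ∈ Set.Ioo 0 a) : HasDerivAt
      (fun t => a / 3 * (t * √(a ^ 2 + t ^ 2)) + a ^ 3 / 6 * arsinh (t / a) +
        1 / 6 * (t ^ 3 * arsinh (a / t)))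
      (∫ y in (0 : ℝ)..a, √(x ^ 2 + y ^ 2)) x := by
    have hx0 : 0 < x := hx.1
    rw [integral_sqrt_sq_add_sq hx0]
    refine HasDerivAt.congr_deriv
      (((((hasDerivAt_id x).mul (hasDerivAt_sqrt_sq_add_sq ha x)).const_mul (a / 3)).add
      ((hasDerivAt_arsinh_div_const ha x).const_mul (a ^ 3 / 6))).add
      ((((hasDerivAt_id x).pow 3).mul (hasDerivAt_arsinh_const_div a hx0)).const_mul (1 / 6))) ?_
    have hpos : 0 < √(x ^ 2 + a ^ 2) := by positivity
    have hsq : √(x ^ 2 + a ^ 2) ^ 2 = x ^ 2 + a ^ 2 := sq_sqrt (by positivity)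
    simp only [id, add_comm (a ^ 2), Pi.pow_apply]
    field_simp
    linear_combination -6 * a * hsq
  have hcont : Continuous fun x : ℝ => ∫ y in (0 : ℝ)..a, √(x ^ 2 + y ^ 2) :=
    intervalIntegral.continuous_parametric_intervalIntegral_of_continuous' (by fun_prop) 0 a
  have hprim : Continuous fun t : ℝ => a / 3 * (t * √(a ^ 2 + t ^ 2)) +
      a ^ 3 / 6 * arsinh (t / a) + 1 / 6 * (t ^ 3 * arsinh (a / t)) :=
    ((by fun_prop : Continuous fun t : ℝ => a / 3 * (t * √(a ^ 2 + t ^ 2))).add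
      (continuous_const.mul (continuous_id.div_const a).arsinh)).add
      (continuous_const.mul (continuous_pow_three_mul_arsinh_const_div a))
  rw [intervalIntegral.integral_eq_sub_of_hasDerivAt_of_le ha.le hprim.continuousOn hderiv
    (hcont.intervalIntegrable _ _), ← two_mul, sqrt_mul zero_le_two, sqrt_sq ha.le,
    div_self ha.ne']
  simp
  ring

/-- The characteristic length of the flat torus `ℝ²/ℤ²` equals `(√2 + arcsinh 1)/6`:
`∫₀¹ ∫₀¹ √(m(x)² + m(y)²) dx dy = (√2 + arcsinh 1)/6` where `m(t) = min t (1 - t)`;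
equivalently, `4 ∫₀^{1/2} ∫₀^{1/2} √(x² + y²) dx dy = (√2 + arcsinh 1)/6`. -/
theorem charLength_flat_torus :
    (∫ x in (0 : ℝ)..1, ∫ y in (0 : ℝ)..1,
        Real.sqrt ((min x (1 - x)) ^ 2 + (min y (1 - y)) ^ 2)) =
      (Real.sqrt 2 + Real.arsinh 1) / 6 ∧
    4 * ∫ x in (0 : ℝ)..(1 / 2), ∫ y in (0 : ℝ)..(1 / 2), Real.sqrt (x ^ 2 + y ^ 2) =
      (Real.sqrt 2 + Real.arsinh 1) / 6 := by
  have quarter : 4 * ∫ x in (0 : ℝ)..(1 / 2), ∫ y in (0 : ℝ)..(1 / 2), √(x ^ 2 + y ^ 2) =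
      (√2 + arsinh 1) / 6 := by
    rw [integral_integral_sqrt_sq_add_sq (by norm_num)]
    ring
  refine ⟨?_, quarter⟩
  have fold_inner (x : ℝ) : ∫ y in (0 : ℝ)..1, √((min x (1 - x)) ^ 2 + (min y (1 - y)) ^ 2) =
      2 * ∫ y in (0 : ℝ)..(1 / 2), √((min x (1 - x)) ^ 2 + y ^ 2) :=
    integral_comp_min_one_sub (f := fun y => √((min x (1 - x)) ^ 2 + y ^ 2)) (by fun_prop)
  have fold_outer := integral_comp_min_one_sub
    (intervalIntegral.continuous_parametric_intervalIntegral_of_continuous'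
      (μ := MeasureTheory.volume) (f := fun x y : ℝ => √(x ^ 2 + y ^ 2)) (by fun_prop) 0 (1 / 2))
  simp only [fold_inner]
  rw [intervalIntegral.integral_const_mul, fold_outer, ← quarter]
  ring
end
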